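/- For every n ≥ 0, F_{n+1}^I(x,y,q)·F_n^I(x,y,q) = Σ_{j=0}^{n} x y^{n−j} q^{(n−j)(n+j−1)+j} (F_j^I(x,y,q))², as an identity in ℤ[x,y,q]. -/

import Mathlib

open Finset MvPolynomial

open scoped Classical

/-- `σ` (a permutation of `[n]` in one-line notation `σ 0, …, σ (n-1)`) contains the
pattern `π` (given by its one-line notation as a function `Fin m → Fin m`) if some
subsequence of `σ` is order isomorphic to `π`. -/
def PermContains {n m : ℕ} (σ : Equiv.Perm (Fin n)) (π : Fin m → Fin m) : Prop :=
  ∃ f : Fin m → Fin n, (∀ a b : Fin m, a < b → f a < f b) ∧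
    ∀ a b : Fin m, σ (f a) < σ (f b) ↔ π a < π b

/-- `σ` avoids the pattern `π`. -/
def PermAvoids {n m : ℕ} (σ : Equiv.Perm (Fin n)) (π : Fin m → Fin m) : Prop :=
  ¬ PermContains σ π

/-- The value `σ i` of the one-line notation of `σ`, as a natural number (0-based). -/
def permVal {n : ℕ} (σ : Equiv.Perm (Fin n)) (i : ℕ) : ℕ :=
  if h : i < n then (σ ⟨i, h⟩ : ℕ) else 0

/-- `inv σ` : the number of inversions, i.e. pairs of positions `i < j` with `σ i > σ j`. -/
def invStat {n : ℕ} (σ : Equiv.Perm (Fin n)) : ℕ :=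
  ((Finset.range n ×ˢ Finset.range n).filter
    fun p => p.1 < p.2 ∧ permVal σ p.2 < permVal σ p.1).card

/-- `maj σ` : the sum of all (1-based) indices `i` with `σ(i) > σ(i+1)`; with 0-based
positions, a descent at positions `i, i+1` contributes `i + 1`. -/
def majStat {n : ℕ} (σ : Equiv.Perm (Fin n)) : ℕ :=
  ∑ i ∈ Finset.range (n - 1), if permVal σ (i + 1) < permVal σ i then i + 1 else 0

/-- The number of ascents of `σ`; for `σ ∈ Sₙ(123,132,213)` (a reverse layered matching)
this equals `d σ`, the number of doubleton blocks. -/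
def ascStat {n : ℕ} (σ : Equiv.Perm (Fin n)) : ℕ :=
  ((Finset.range (n - 1)).filter fun i => permVal σ i < permVal σ (i + 1)).card

/-- The number of descents of `σ`; for `σ ∈ Sₙ(231,312,321)` (a layered matching)
this equals `d σ`, the number of doubleton blocks. -/
def descStat {n : ℕ} (σ : Equiv.Perm (Fin n)) : ℕ :=
  ((Finset.range (n - 1)).filter fun i => permVal σ (i + 1) < permVal σ i).card

/-- `Sₙ(123, 132, 213)` : permutations of `[n]` avoiding `123`, `132` and `213`
(patterns written 0-based). -/
noncomputable def S123 (n : ℕ) : Finset (Equiv.Perm (Fin n)) :=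
  Finset.univ.filter fun σ =>
    PermAvoids σ ![0, 1, 2] ∧ PermAvoids σ ![0, 2, 1] ∧ PermAvoids σ ![1, 0, 2]

/-- `Sₙ(231, 312, 321)` : permutations of `[n]` avoiding `231`, `312` and `321`
(patterns written 0-based). -/
noncomputable def S231 (n : ℕ) : Finset (Equiv.Perm (Fin n)) :=
  Finset.univ.filter fun σ =>
    PermAvoids σ ![1, 2, 0] ∧ PermAvoids σ ![2, 0, 1] ∧ PermAvoids σ ![2, 1, 0]

/-- `Fₙᴵ(x, y, q) = Σ_{σ ∈ Sₙ(123,132,213)} x^(s σ) * y^(d σ) * q^(inv σ)` in `ℤ[x,y,q]`,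
where `d σ = ascStat σ` is the number of doubletons and `s σ = n - 2 * d σ` the number of
singletons; here `x = X 0`, `y = X 1`, `q = X 2`. -/
noncomputable def FI (n : ℕ) : MvPolynomial (Fin 3) ℤ :=
  ∑ σ ∈ S123 n, X 0 ^ (n - 2 * ascStat σ) * X 1 ^ ascStat σ * X 2 ^ invStat σ

lemma permVal_of_lt {n : ℕ} (σ : Equiv.Perm (Fin n)) {i : ℕ} (h : i < n) :
    permVal σ i = σ ⟨i, h⟩ := by
  simp [permVal, h]

lemma permVal_lt {n : ℕ} (σ : Equiv.Perm (Fin n)) {i : ℕ} (h : i < n) : permVal σ i < n := by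
  simp [permVal, h]

lemma permVal_inj {n : ℕ} (σ : Equiv.Perm (Fin n)) {i j : ℕ} (hi : i < n) (hj : j < n)
    (h : permVal σ i = permVal σ j) : i = j := by
  rw [permVal_of_lt σ hi, permVal_of_lt σ hj] at h
  simpa using σ.injective (Fin.ext h)

lemma exists_permVal_eq {n : ℕ} (σ : Equiv.Perm (Fin n)) {v : ℕ} (h : v < n) :
    ∃ i < n, permVal σ i = v :=
  ⟨σ.symm ⟨v, h⟩, (σ.symm ⟨v, h⟩).isLt, by simp [permVal]⟩

lemma permVal_ext {n : ℕ} {σ τ : Equiv.Perm (Fin n)} (h : ∀ i, permVal σ i = permVal τ i) :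
    σ = τ := by
  ext i
  simpa [permVal] using h i

/-- A length-three pattern occurs in `σ` as soon as three increasing positions carry values in
the prescribed relative order. -/
lemma permContains_of_triple {n : ℕ} {σ : Equiv.Perm (Fin n)} {π : Fin 3 → Fin 3} {i j k : Fin n}
    (hij : i < j) (hjk : j < k) (h : ∀ a b, σ (![i, j, k] a) < σ (![i, j, k] b) ↔ π a < π b) :
    PermContains σ π := by
  refine ⟨![i, j, k], ?_, h⟩
  have := hij.trans hjk
  intro a b hab
  fin_cases a <;> fin_cases b <;> simp_all

lemma lt_of_permAvoids {n : ℕ} {σ : Equiv.Perm (Fin n)} (h₁ : PermAvoids σ ![0, 1, 2])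
    (h₂ : PermAvoids σ ![0, 2, 1]) (h₃ : PermAvoids σ ![1, 0, 2]) {a b c : Fin n}
    (hab : a < b) (hbc : b < c) : σ c < σ a := by
  by_contra! hle
  have hac : σ a < σ c := lt_of_le_of_ne hle (σ.injective.ne (hab.trans hbc).ne)
  rcases lt_or_gt_of_ne (σ.injective.ne hab.ne) with hlt | hgt
  · rcases lt_or_gt_of_ne (σ.injective.ne hbc.ne) with hlt' | hgt'
    · refine h₁ (permContains_of_triple hab hbc fun u v => ?_)
      fin_cases u <;> fin_cases v <;> simp [hac, hlt, hlt', hac.le, hlt.le, hlt'.le]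
    · refine h₂ (permContains_of_triple hab hbc fun u v => ?_)
      fin_cases u <;> fin_cases v <;> simp [hac, hlt, hgt', hac.le, hlt.le, hgt'.le]
  · have hbc' := hgt.trans hac
    refine h₃ (permContains_of_triple hab hbc fun u v => ?_)
    fin_cases u <;> fin_cases v <;> simp [hac, hgt, hbc', hac.le, hgt.le, hbc'.le]

/-- Avoiding `123`, `132` and `213` means that any two entries at distance at least two form
an inversion. -/
lemma mem_S123_iff {n : ℕ} {σ : Equiv.Perm (Fin n)} :
    σ ∈ S123 n ↔ ∀ i k, i + 2 ≤ k → k < n → permVal σ k < permVal σ i := by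
  simp only [S123, mem_filter, mem_univ, true_and]
  constructor
  · rintro ⟨h₁, h₂, h₃⟩ i k hik hk
    rw [permVal_of_lt σ hk, permVal_of_lt σ (by omega : i < n)]
    exact lt_of_permAvoids h₁ h₂ h₃ (b := ⟨i + 1, by omega⟩) (by simp)
      (by rw [Fin.mk_lt_mk]; omega)
  · intro h
    have key : ∀ π : Fin 3 → Fin 3, π 0 < π 2 → PermAvoids σ π := by
      rintro π hπ ⟨f, hf, hσ⟩
      have h₁ : f 0 < f 1 := hf 0 1 (by decide)
      have h₂ : f 1 < f 2 := hf 1 2 (by decide)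
      have h₃ := h (f 0) (f 2) (by simp only [Fin.lt_def] at h₁ h₂; omega) (f 2).isLt
      simp only [permVal, Fin.is_lt, dite_true, Fin.eta] at h₃
      exact lt_asymm h₃ ((hσ 0 2).2 hπ)
    exact ⟨key _ (by decide), key _ (by decide), key _ (by decide)⟩

lemma ascStat_eq_sum {n : ℕ} (σ : Equiv.Perm (Fin n)) :
    ascStat σ = ∑ i ∈ range (n - 1), if permVal σ i < permVal σ (i + 1) then 1 else 0 := by
  rw [ascStat, card_filter]

lemma invStat_eq_sum {n : ℕ} (σ : Equiv.Perm (Fin n)) :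
    invStat σ = ∑ i ∈ range n, ∑ j ∈ range n,
      if i < j ∧ permVal σ j < permVal σ i then 1 else 0 := by
  rw [invStat, card_filter, sum_product]

/-- The permutation `(n+1) σ` of `[n+1]`: prepend a singleton block to `σ`. -/
def consSingle {n : ℕ} (σ : Equiv.Perm (Fin n)) : Equiv.Perm (Fin (n + 1)) :=
  (finSuccEquiv n).trans ((Equiv.optionCongr σ).trans finSuccEquivLast.symm)

/-- The permutation `(n+1) (n+2) σ` of `[n+2]`: prepend a doubleton block to `σ`. -/
def consDouble {n : ℕ} (σ : Equiv.Perm (Fin n)) : Equiv.Perm (Fin (n + 2)) :=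
  (Equiv.swap 0 1).trans (consSingle (consSingle σ))

section Blocks

variable {n : ℕ} (σ : Equiv.Perm (Fin n))

@[simp] lemma permVal_consSingle_zero : permVal (consSingle σ) 0 = n := by
  simp [permVal, consSingle]

@[simp] lemma permVal_consSingle_succ (i : ℕ) :
    permVal (consSingle σ) (i + 1) = permVal σ i := by
  by_cases h : i < n
  · have : (⟨i + 1, by omega⟩ : Fin (n + 1)) = Fin.succ ⟨i, h⟩ := rfl
    rw [permVal_of_lt _ (by omega), permVal_of_lt σ h, this]
    simp [consSingle, -Fin.succ_mk]
  · simp [permVal, h]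

@[simp] lemma permVal_consDouble_zero : permVal (consDouble σ) 0 = n := by
  have h := permVal_consSingle_succ (consSingle σ) 0
  rw [permVal_consSingle_zero] at h
  simpa [permVal, consDouble] using h

@[simp] lemma permVal_consDouble_one : permVal (consDouble σ) 1 = n + 1 := by
  have := permVal_consSingle_zero (consSingle σ)
  simpa [permVal, consDouble] using this

@[simp] lemma permVal_consDouble_add_two (i : ℕ) :
    permVal (consDouble σ) (i + 2) = permVal σ i := by
  rw [← permVal_consSingle_succ σ, ← permVal_consSingle_succ (consSingle σ)]
  by_cases h : i < n
  · rw [permVal_of_lt _ (by omega), permVal_of_lt _ (by omega), consDouble, Equiv.trans_apply,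
      Equiv.swap_apply_of_ne_of_ne] <;> simp [Fin.ext_iff]
  · simp [permVal, h]

lemma consSingle_injective : Function.Injective (consSingle (n := n)) := fun σ τ h =>
  permVal_ext fun i => by rw [← permVal_consSingle_succ, h, permVal_consSingle_succ]

lemma consDouble_injective : Function.Injective (consDouble (n := n)) := fun σ τ h =>
  permVal_ext fun i => by rw [← permVal_consDouble_add_two, h, permVal_consDouble_add_two]

lemma exists_eq_consSingle {τ : Equiv.Perm (Fin (n + 1))} (h : permVal τ 0 = n) :
    ∃ σ, consSingle σ = τ := by
  have h0 : τ 0 = Fin.last n := by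
    ext
    simpa [permVal] using h
  set e := (finSuccEquiv n).symm.trans (τ.trans finSuccEquivLast) with he
  have hnone : e none = none := by simp [he, h0]
  have hcongr : Equiv.optionCongr (Equiv.removeNone e) = e := by
    ext1 x
    cases x with
    | none => simp [hnone]
    | some x =>
      refine Equiv.removeNone_some e (Option.ne_none_iff_exists'.1 fun hx => ?_)
      simpa using e.injective (hx.trans hnone.symm)
  refine ⟨Equiv.removeNone e, ?_⟩
  rw [consSingle, hcongr]
  ext i
  simp [he]

lemma exists_eq_consDouble {τ : Equiv.Perm (Fin (n + 2))} (h0 : permVal τ 0 = n)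
    (h1 : permVal τ 1 = n + 1) : ∃ σ, consDouble σ = τ := by
  obtain ⟨ρ, hρ⟩ := exists_eq_consSingle (τ := (Equiv.swap 0 1).trans τ)
    (by simpa [permVal] using h1)
  obtain ⟨σ, hσ⟩ := exists_eq_consSingle (τ := ρ)
    (by rw [← permVal_consSingle_succ, hρ]; simpa [permVal] using h0)
  refine ⟨σ, ?_⟩
  rw [consDouble, hσ, hρ]
  ext i
  simp

lemma consSingle_mem_S123 : consSingle σ ∈ S123 (n + 1) ↔ σ ∈ S123 n := by
  simp only [mem_S123_iff]
  constructor
  · intro h i k hik hk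
    simpa using h (i + 1) (k + 1) (by omega) (by omega)
  · rintro h (_ | i) (_ | k) hik hk
    · omega
    · simpa using permVal_lt σ (by omega : k < n)
    · omega
    · simpa using h i k (by omega) (by omega)

lemma consDouble_mem_S123 : consDouble σ ∈ S123 (n + 2) ↔ σ ∈ S123 n := by
  simp only [mem_S123_iff]
  constructor
  · intro h i k hik hk
    simpa using h (i + 2) (k + 2) (by omega) (by omega)
  · rintro h (_ | _ | i) (_ | _ | k) hik hk
    any_goals omega
    · simpa using permVal_lt σ (by omega : k < n)
    · simpa using (permVal_lt σ (by omega : k < n)).trans (Nat.lt_succ_self n)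
    · simpa using h i k (by omega) (by omega)

lemma ascStat_consSingle : ascStat (consSingle σ) = ascStat σ := by
  rw [ascStat_eq_sum, ascStat_eq_sum]
  cases n with
  | zero => simp
  | succ m =>
    have := permVal_lt σ m.succ_pos
    simp only [Nat.add_sub_cancel, sum_range_succ' _ m, permVal_consSingle_succ,
      permVal_consSingle_zero]
    rw [if_neg (by omega), add_zero]

lemma ascStat_consDouble : ascStat (consDouble σ) = ascStat σ + 1 := by
  rw [ascStat_eq_sum, ascStat_eq_sum]
  cases n with
  | zero => simp [-sum_boole]
  | succ m =>
    have := permVal_lt σ m.succ_pos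
    have h2 : ¬ permVal (consDouble σ) (0 + 1) < permVal (consDouble σ) (0 + 1 + 1) := by
      rw [permVal_consDouble_add_two, zero_add, permVal_consDouble_one]
      omega
    rw [show m + 1 + 2 - 1 = m + 1 + 1 by omega, sum_range_succ', sum_range_succ', if_neg h2]
    simp [-sum_boole]

lemma invStat_consSingle : invStat (consSingle σ) = invStat σ + n := by
  have h : ∀ j ∈ range n, (if permVal σ j < n then 1 else 0) = 1 := fun j hj =>
    if_pos (permVal_lt σ (mem_range.1 hj))
  rw [invStat_eq_sum, invStat_eq_sum]
  simp [sum_range_succ' _ n, -sum_boole, sum_congr rfl h]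

lemma invStat_consDouble : invStat (consDouble σ) = invStat σ + 2 * n := by
  have h : ∀ j ∈ range n, (if permVal σ j < n then 1 else 0) = 1 := fun j hj =>
    if_pos (permVal_lt σ (mem_range.1 hj))
  have h' : ∀ j ∈ range n, (if permVal σ j ≤ n then 1 else 0) = 1 := fun j hj =>
    if_pos (permVal_lt σ (mem_range.1 hj)).le
  rw [invStat_eq_sum, invStat_eq_sum]
  simp [sum_range_succ' _ n, sum_range_succ' _ (n + 1), -sum_boole, sum_congr rfl h,
    sum_congr rfl h']
  omega

end Blocks

lemma S123_add_two (n : ℕ) :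
    S123 (n + 2) = (S123 (n + 1)).image consSingle ∪ (S123 n).image consDouble := by
  ext τ
  simp only [mem_union, mem_image]
  constructor
  · intro hτ
    have h := mem_S123_iff.1 hτ
    obtain ⟨p, hp, hpv⟩ := exists_permVal_eq τ (by omega : n + 1 < n + 2)
    have h0 := permVal_lt τ (by omega : 0 < n + 2)
    obtain rfl | rfl | hp2 : p = 0 ∨ p = 1 ∨ 2 ≤ p := by omega
    · obtain ⟨σ, rfl⟩ := exists_eq_consSingle hpv
      exact Or.inl ⟨σ, (consSingle_mem_S123 σ).1 hτ, rfl⟩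
    · obtain ⟨m, hm, hmv⟩ := exists_permVal_eq τ (by omega : n < n + 2)
      have hne : permVal τ 0 ≠ permVal τ 1 := fun e => by
        simpa using permVal_inj τ (by omega) hp e
      obtain rfl | rfl | hm2 : m = 0 ∨ m = 1 ∨ 2 ≤ m := by omega
      · obtain ⟨σ, rfl⟩ := exists_eq_consDouble hmv hpv
        exact Or.inr ⟨σ, (consDouble_mem_S123 σ).1 hτ, rfl⟩
      · omega
      · have := h 0 m hm2 hm
        omega
    · have := h 0 p hp2 hp
      omega
  · rintro (⟨σ, hσ, rfl⟩ | ⟨σ, hσ, rfl⟩)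
    · exact (consSingle_mem_S123 σ).2 hσ
    · exact (consDouble_mem_S123 σ).2 hσ

lemma two_mul_ascStat_le {n : ℕ} {σ : Equiv.Perm (Fin n)} (hσ : σ ∈ S123 n) :
    2 * ascStat σ ≤ n := by
  induction n using Nat.twoStepInduction with
  | zero => simp [ascStat]
  | one => simp [ascStat]
  | more n ih₀ ih₁ =>
    rw [S123_add_two, mem_union, mem_image, mem_image] at hσ
    obtain ⟨ρ, hρ, rfl⟩ | ⟨ρ, hρ, rfl⟩ := hσ
    · have := ih₁ hρ
      rw [ascStat_consSingle]
      omega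
    · have := ih₀ hρ
      rw [ascStat_consDouble]
      omega

lemma S123_eq_univ {n : ℕ} (hn : n ≤ 2) : S123 n = univ :=
  eq_univ_of_forall fun _ => mem_S123_iff.2 fun _ _ _ _ => by omega

lemma FI_zero : FI 0 = 1 := by
  simp [FI, S123_eq_univ, ascStat, invStat]

lemma FI_one : FI 1 = X 0 := by
  simp [FI, S123_eq_univ, ascStat, invStat_eq_sum, -sum_boole]

/-- Removing the first block of a reverse layered matching gives a two-term recurrence. -/
lemma FI_add_two (n : ℕ) :
    FI (n + 2) = X 0 * X 2 ^ (n + 1) * FI (n + 1) + X 1 * X 2 ^ (2 * n) * FI n := by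
  have hdisj : Disjoint ((S123 (n + 1)).image consSingle) ((S123 n).image consDouble) := by
    rw [disjoint_left]
    rintro _ hσ hρ
    obtain ⟨σ, -, rfl⟩ := mem_image.1 hσ
    obtain ⟨ρ, -, h⟩ := mem_image.1 hρ
    have h0 : permVal (consDouble ρ) 0 = permVal (consSingle σ) 0 := by rw [h]
    simp at h0
  simp only [FI]
  rw [S123_add_two, sum_union hdisj, sum_image consSingle_injective.injOn,
    sum_image consDouble_injective.injOn, mul_sum, mul_sum]
  refine congrArg₂ (· + ·) ?_ ?_
  · refine sum_congr rfl fun σ hσ => ?_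
    have := two_mul_ascStat_le hσ
    rw [ascStat_consSingle, invStat_consSingle,
      show n + 2 - 2 * ascStat σ = n + 1 - 2 * ascStat σ + 1 by omega]
    ring
  · refine sum_congr rfl fun σ _ => ?_
    rw [ascStat_consDouble, invStat_consDouble,
      show n + 2 - 2 * (ascStat σ + 1) = n - 2 * ascStat σ by omega]
    ring

/-- `F_{n+1}ᴵ Fₙᴵ = Σ_{j=0}^{n} x y^(n-j) q^((n-j)(n+j-1)+j) (Fⱼᴵ)²` in `ℤ[x,y,q]`. -/
theorem stmt17 (n : ℕ) :
    FI (n + 1) * FI n = ∑ j ∈ Finset.range (n + 1),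
      X 0 * X 1 ^ (n - j) * X 2 ^ ((n - j) * (n + j - 1) + j) * FI j ^ 2 := by
  induction n with
  | zero => simp [FI_zero, FI_one]
  | succ n ih =>
    have hstep : ∀ j ∈ range (n + 1),
        (X 0 * X 1 ^ (n + 1 - j) * X 2 ^ ((n + 1 - j) * (n + 1 + j - 1) + j) * FI j ^ 2 :
          MvPolynomial (Fin 3) ℤ) =
        X 1 * X 2 ^ (2 * n) *
          (X 0 * X 1 ^ (n - j) * X 2 ^ ((n - j) * (n + j - 1) + j) * FI j ^ 2) := by
      intro j hj
      obtain ⟨d, rfl⟩ := Nat.exists_eq_add_of_le (Nat.lt_succ_iff.1 (mem_range.1 hj))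
      have hexp : (d + 1) * (j + d + j) = 2 * (j + d) + d * (j + d + j - 1) := by
        cases d with
        | zero => ring
        | succ e =>
          rw [show j + (e + 1) + j - 1 = j + e + j by omega]
          ring
      rw [show j + d + 1 - j = d + 1 by omega, show j + d + 1 + j - 1 = j + d + j by omega,
        Nat.add_sub_cancel_left, hexp]
      ring
    rw [sum_range_succ, sum_congr rfl hstep, ← mul_sum, ← ih, FI_add_two]
    simp only [Nat.sub_self, zero_mul, zero_add, pow_zero]
    ring
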